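/- Every order-based semantics is stabilizing: if ⪯ is a suitable order, then for every database D and every sequence (R_i) of regular expressions whose languages L(R_i) form a non-decreasing chain, the sequence of sets S_⪯(D,R_i) is eventually constant. -/

import Mathlib

namespace RPQ

/-- Vertex identifiers. -/
abbrev V : Type := ℕ
/-- Edge identifiers. -/
abbrev Edg : Type := ℕ
/-- Labels. -/
abbrev Lab : Type := ℕ

/-- A walk: a nonempty alternating sequence `v₀,e₁,v₁,…,e_k,v_k`, encoded as the
initial vertex together with the list of (edge, next-vertex) pairs. -/
structure Walk where
  head : V
  steps : List (Edg × V)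
deriving DecidableEq

namespace Walk

def length (w : Walk) : ℕ := w.steps.length
def src (w : Walk) : V := w.head
def tgt (w : Walk) : V := (w.steps.map Prod.snd).getLastD w.head
/-- The pair of endpoints of a walk. -/
def ep (w : Walk) : V × V := (w.src, w.tgt)
def vertexList (w : Walk) : List V := w.head :: w.steps.map Prod.snd
def edgeList (w : Walk) : List Edg := w.steps.map Prod.fst
/-- Concatenation of walks (meaningful when `w.tgt = w'.src`). -/
def concat (w w' : Walk) : Walk := ⟨w.head, w.steps ++ w'.steps⟩

end Walk

/-- A graph database. -/
structure Database where
  labels : Finset Lab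
  verts : Finset V
  edges : Finset Edg
  src : Edg → V
  tgt : Edg → V
  lbl : Edg → Lab
  src_mem : ∀ e ∈ edges, src e ∈ verts
  tgt_mem : ∀ e ∈ edges, tgt e ∈ verts
  lbl_mem : ∀ e ∈ edges, lbl e ∈ labels

def chainFrom (D : Database) : V → List (Edg × V) → Prop
  | _, [] => True
  | v, (e, v') :: rest =>
      e ∈ D.edges ∧ D.src e = v ∧ D.tgt e = v' ∧ chainFrom D v' rest

/-- `w` is consistent with `D`, i.e. `w` is a walk in `D`. -/
def Walk.Consistent (D : Database) (w : Walk) : Prop :=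
  w.head ∈ D.verts ∧ chainFrom D w.head w.steps

/-- The set of walks in `D`. -/
def Walks (D : Database) : Set Walk := {w | w.Consistent D}

/-- The label of a walk in `D`: the word of its successive edge labels. -/
def Walk.label (D : Database) (w : Walk) : List Lab :=
  w.steps.map fun p => D.lbl p.1

abbrev RE := RegularExpression Lab

/-- Matches of `R` in `D`: walks in `D` whose label conforms to `R`. -/
def Matches (D : Database) (R : RE) : Set Walk :=
  {w | w.Consistent D ∧ w.label D ∈ R.matches'}

/-- A semantics maps a database and a query to a finite subset of its matches. -/
def IsSemantics (S : Database → RE → Set Walk) : Prop :=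
  ∀ D R, S D R ⊆ Matches D R ∧ (S D R).Finite

/-- `S` is walk-based. -/
def WalkBased (S : Database → RE → Set Walk) : Prop :=
  ∃ r : Set Walk → Set Walk, ∀ D R, S D R = r (Matches D R)

/-- The semantics defined by a filter `f`. -/
def FilterSem (f : Walk → Bool) (D : Database) (R : RE) : Set Walk :=
  {w ∈ Matches D R | f w = true}

/-- Componentwise inclusion of databases. -/
def Database.Sub (D D' : Database) : Prop :=
  D.labels ⊆ D'.labels ∧ D.verts ⊆ D'.verts ∧ D.edges ⊆ D'.edges ∧
    ∀ e ∈ D.edges, D'.src e = D.src e ∧ D'.tgt e = D.tgt e ∧ D'.lbl e = D.lbl e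

def IsPartialOrderRel (le : Walk → Walk → Prop) : Prop :=
  (∀ w, le w w) ∧ (∀ a b c, le a b → le b c → le a c) ∧ ∀ a b, le a b → le b a → a = b

/-- `le` is a well-partial-order on the walks of `D`. -/
def IsWpoOn (le : Walk → Walk → Prop) (D : Database) : Prop :=
  ∀ f : ℕ → Walk, (∀ n, (f n).Consistent D) → ∃ i j, i < j ∧ le (f i) (f j)

/-- Suitable order: a partial order on walks that is a wpo on `Walks D` for each `D`. -/
def Suitable (le : Walk → Walk → Prop) : Prop :=
  IsPartialOrderRel le ∧ ∀ D, IsWpoOn le D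

/-- The semantics based on the order `le`: the `le`-minimal matches among those
with the same endpoints. -/
def OrderSem (le : Walk → Walk → Prop) (D : Database) (R : RE) : Set Walk :=
  {w ∈ Matches D R | ∀ w' ∈ Matches D R, w'.ep = w.ep → le w' w → w' = w}

def Monotonous (S : Database → RE → Set Walk) : Prop :=
  ∀ D D' R, D.Sub D' → S D R ⊆ S D' R

def CoMonotonous (S : Database → RE → Set Walk) : Prop :=
  ∀ D D' R, D.Sub D' → S D' R ∩ Walks D ⊆ S D R

def Stabilizing (S : Database → RE → Set Walk) : Prop :=
  ∀ (D : Database) (Rs : ℕ → RE),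
    (∀ i j, i ≤ j → ∀ u, u ∈ (Rs i).matches' → u ∈ (Rs j).matches') →
    ∃ N, ∀ n, N ≤ n → S D (Rs n) = S D (Rs N)

/-- Concatenation lifted to sets of walks. -/
def setConcat (W W' : Set Walk) : Set Walk :=
  {u | ∃ w ∈ W, ∃ w' ∈ W', w.tgt = w'.src ∧ u = w.concat w'}

/-- `setStar W` : all concatenations `w₁·…·w_k` (k ≥ 1) of walks of `W`. -/
inductive setStar (W : Set Walk) : Walk → Prop
  | base : ∀ w ∈ W, setStar W w
  | step : ∀ u w, setStar W u → w ∈ W → u.tgt = w.src → setStar W (u.concat w)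

/-- Walks jointly consistent with some database. -/
def ConsistentPair (w w' : Walk) : Prop :=
  ∃ D : Database, w.Consistent D ∧ w'.Consistent D

/-- The trimming of an order. -/
def trimRel (le : Walk → Walk → Prop) (w w' : Walk) : Prop :=
  ConsistentPair w w' ∧ w.ep = w'.ep ∧ le w w'

def Trimmed (le : Walk → Walk → Prop) : Prop := trimRel le = le

/-- `le` respects element inclusion. -/
def RespectsElemIncl (le : Walk → Walk → Prop) : Prop :=
  ∀ w w', le w w' →
    (∀ v ∈ w.vertexList, v ∈ w'.vertexList) ∧ ∀ e ∈ w.edgeList, e ∈ w'.edgeList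

/-- Action of a relabeling on a database. -/
def Database.relabel (π : Equiv.Perm Lab) (D : Database) : Database where
  labels := D.labels.image (⇑π)
  verts := D.verts
  edges := D.edges
  src := D.src
  tgt := D.tgt
  lbl := fun e => π (D.lbl e)
  src_mem := D.src_mem
  tgt_mem := D.tgt_mem
  lbl_mem := fun e he => Finset.mem_image_of_mem (⇑π) (D.lbl_mem e he)

/-- Action of a renaming on a walk. -/
def Walk.rename (νv : Equiv.Perm V) (νe : Equiv.Perm Edg) (w : Walk) : Walk :=
  ⟨νv w.head, w.steps.map fun p => (νe p.1, νv p.2)⟩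

/-- Action of a renaming on a database. -/
def Database.rename (νv : Equiv.Perm V) (νe : Equiv.Perm Edg) (D : Database) :
    Database where
  labels := D.labels
  verts := D.verts.image (⇑νv)
  edges := D.edges.image (⇑νe)
  src := fun e => νv (D.src (νe.symm e))
  tgt := fun e => νv (D.tgt (νe.symm e))
  lbl := fun e => D.lbl (νe.symm e)
  src_mem := by
    intro e he
    obtain ⟨e', he', rfl⟩ := Finset.mem_image.mp he
    simpa using Finset.mem_image_of_mem (⇑νv) (D.src_mem e' he')
  tgt_mem := by
    intro e he
    obtain ⟨e', he', rfl⟩ := Finset.mem_image.mp he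
    simpa using Finset.mem_image_of_mem (⇑νv) (D.tgt_mem e' he')
  lbl_mem := by
    intro e he
    obtain ⟨e', he', rfl⟩ := Finset.mem_image.mp he
    simpa using D.lbl_mem e' he'

/-- Identifier independence. -/
def IdIndependent (S : Database → RE → Set Walk) : Prop :=
  ∀ (νv : Equiv.Perm V) (νe : Equiv.Perm Edg) (D : Database) (R : RE),
    Walk.rename νv νe '' S D R = S (Database.rename νv νe D) R

/-- Unbounded semantics. -/
def Unbounded (S : Database → RE → Set Walk) : Prop :=
  ∀ n : ℕ, ∃ (D : Database) (R : RE) (w : Walk), w ∈ S D R ∧ n ≤ w.length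

/-- Shortest-walk semantics. -/
def Sh (D : Database) (R : RE) : Set Walk :=
  {w ∈ Matches D R | ∀ w' ∈ Matches D R, w'.ep = w.ep → w.length ≤ w'.length}

/-- The factor-inserting relation `F`. -/
def FactorIns (w w' : Walk) : Prop :=
  ∃ w₁ w₂ w₃ : Walk, w₁.tgt = w₂.src ∧ w₂.tgt = w₃.src ∧ w₁.tgt = w₃.src ∧
    w = w₁.concat w₃ ∧ w' = (w₁.concat w₂).concat w₃

/-- The subwalk order: reflexive–transitive closure of `FactorIns`. -/
def SubwalkOrd : Walk → Walk → Prop := Relation.ReflTransGen FactorIns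

/-- In a partial order, the sets of minimal elements of a non-decreasing chain of subsets of a
partially well-ordered set are eventually constant. -/
theorem setOf_minimal_eventually_const {α : Type*} [PartialOrder α] {S : Set α} (hS : S.IsPWO)
    (A : ℕ → Set α) (hA : Monotone A) (hAS : ∀ n, A n ⊆ S) :
    ∃ N, ∀ n, N ≤ n → {x | Minimal (· ∈ A n) x} = {x | Minimal (· ∈ A N) x} := by
  set U : Set α := ⋃ n, A n
  have hUS : U.IsPWO := hS.mono (Set.iUnion_subset hAS)
  have hAU : ∀ n, A n ⊆ U := Set.subset_iUnion A
  have hfin : {x | Minimal (· ∈ U) x}.Finite :=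
    (setOfPred_minimal_antichain (· ∈ U)).finite_of_partiallyWellOrderedOn
      (hUS.mono fun _ hx => hx.prop)
  obtain ⟨N, hN⟩ : ∃ N, {x | Minimal (· ∈ U) x} ⊆ A N := by
    simpa using hA.directed_le.exists_mem_subset_of_finset_subset_biUnion
      (s := hfin.toFinset) (by
        rw [hfin.coe_toFinset]
        exact fun x hx => hx.prop)
  have key : ∀ n, N ≤ n → {x | Minimal (· ∈ A n) x} = {x | Minimal (· ∈ U) x} := by
    intro n hn
    ext x
    constructor
    · intro hx
      obtain ⟨m, hmx, hm⟩ := hUS.exists_le_minimal (hAU n hx.prop)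
      rwa [Set.mem_ofPred_eq, ← hx.eq_of_le (hA hn (hN hm)) hmx]
    · intro hx
      exact ⟨hA hn (hN hx), fun y hy hyx => hx.le_of_le (hAU n hy) hyx⟩
  exact ⟨N, fun n hn => (key n hn).trans (key N le_rfl).symm⟩

theorem chainFrom_getLastD_mem (D : Database) (l : List (Edg × V)) (v : V) (hv : v ∈ D.verts)
    (h : chainFrom D v l) : (l.map Prod.snd).getLastD v ∈ D.verts := by
  induction l generalizing v with
  | nil => simpa using hv
  | cons p rest ih =>
    obtain ⟨he, -, ht, hrest⟩ := h
    rw [List.map_cons, List.getLastD_cons]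
    exact ih p.2 (ht ▸ D.tgt_mem _ he) hrest

theorem Walk.Consistent.ep_mem {D : Database} {w : Walk} (hw : w.Consistent D) :
    w.ep ∈ D.verts ×ˢ D.verts :=
  Finset.mem_product.2 ⟨hw.1, chainFrom_getLastD_mem D w.steps w.head hw.1 hw.2⟩

/-- The restriction of a partial order to pairs of walks with the same endpoints. -/
abbrev sameEndpointsOrder {le : Walk → Walk → Prop} (h : IsPartialOrderRel le) :
    PartialOrder Walk where
  le a b := le a b ∧ a.ep = b.ep
  le_refl a := ⟨h.1 a, rfl⟩
  le_trans a b c hab hbc := ⟨h.2.1 a b c hab.1 hbc.1, hab.2.trans hbc.2⟩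
  le_antisymm a b hab hba := h.2.2 a b hab.1 hba.1

theorem IsWpoOn.sameEndpoints {le : Walk → Walk → Prop} (h : IsPartialOrderRel le)
    {D : Database} (hD : IsWpoOn le D) :
    (Walks D).PartiallyWellOrderedOn fun a b => le a b ∧ a.ep = b.ep := by
  have : IsPreorder Walk le := { refl := h.1, trans := h.2.1 }
  have hW : (Walks D).PartiallyWellOrderedOn le :=
    Set.partiallyWellOrderedOn_iff_exists_lt.2 hD
  have hE : (↑(D.verts ×ˢ D.verts) : Set (V × V)).PartiallyWellOrderedOn (· = ·) :=
    Finset.partiallyWellOrderedOn _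
  have := (hW.prod hE).mono (s := (fun w => (w, w.ep)) '' Walks D) (by
    rintro _ ⟨w, hw, rfl⟩
    exact ⟨hw, hw.ep_mem⟩)
  refine (this.image_of_monotone_on (f := Prod.fst) ?_).mono fun w hw =>
    ⟨(w, w.ep), ⟨w, hw, rfl⟩, rfl⟩
  rintro _ ⟨a, -, rfl⟩ _ ⟨b, -, rfl⟩ hab
  exact hab

theorem orderSem_eq_setOf_minimal {le : Walk → Walk → Prop} (h : IsPartialOrderRel le)
    (D : Database) (R : RE) :
    letI := sameEndpointsOrder h
    OrderSem le D R = {w | Minimal (· ∈ Matches D R) w} := by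
  let _ := sameEndpointsOrder h
  ext w
  constructor
  · rintro ⟨hw, hmin⟩
    exact ⟨hw, fun w' hw' hle => (hmin w' hw' hle.2 hle.1).ge⟩
  · intro hw
    exact ⟨hw.prop, fun w' hw' hep hle => hw.eq_of_le hw' ⟨hle, hep⟩⟩

/-- Every order-based semantics is stabilizing. -/
theorem every_orderBased_stabilizing
    (le : Walk → Walk → Prop) (hle : Suitable le) :
    Stabilizing (OrderSem le) := by
  let _ := sameEndpointsOrder hle.1
  intro D Rs hRs
  simp only [orderSem_eq_setOf_minimal hle.1]
  exact setOf_minimal_eventually_const (IsWpoOn.sameEndpoints hle.1 (hle.2 D)) _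
    (fun i j hij w hw => ⟨hw.1, hRs i j hij _ hw.2⟩) fun n w hw => hw.1

end RPQ
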